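/- arXiv:2202.12017 — 6 statements merged into one kernel-verified Lean document; each statement's English description precedes it below -/
import Mathlib

section
/- Let A be a commutative ring and M an A-module which is both flat and 2-almost projective. Then M is a projective A-module. -/
/-- An `A`-module `M` is *2-almost projective* if it is a direct summand of `P ⊕ F`
where `P` is a projective `A`-module and `F` is a finitely presented `A`-module
(equivalently, there is a split surjection `P ⊕ F → M`). -/
def IsTwoAlmostProjective (A : Type u) [CommRing A] (M : Type v)
    [AddCommGroup M] [Module A M] : Prop :=
  ∃ (P : Type v) (F : Type v) (_ : AddCommGroup P) (_ : AddCommGroup F)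
    (_ : Module A P) (_ : Module A F),
    Module.Projective A P ∧ Module.FinitePresentation A F ∧
      ∃ (π : (P × F) →ₗ[A] M) (σ : M →ₗ[A] P × F), π ∘ₗ σ = LinearMap.id

/-- **Drinfeld's lemma**: a flat 2-almost projective module over a commutative ring
is projective. -/
theorem Module.projective_of_flat_of_isTwoAlmostProjective
    (A : Type u) [CommRing A] (M : Type v) [AddCommGroup M] [Module A M]
    [Module.Flat A M] (h : IsTwoAlmostProjective A M) :
    Module.Projective A M := by
  obtain ⟨P, F, _, _, _, _, _, _, π, σ, hπσ⟩ := h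
  obtain ⟨k, f, g, hfg⟩ :=
    Module.Flat.exists_factorization_of_finitePresentation (π ∘ₗ LinearMap.inr A P F)
  refine Module.Projective.of_split (LinearMap.prodMap LinearMap.id f ∘ₗ σ)
    (LinearMap.coprod (π ∘ₗ LinearMap.inl A P F) g) ?_
  have hfactor : LinearMap.coprod (π ∘ₗ LinearMap.inl A P F) g ∘ₗ
      LinearMap.prodMap LinearMap.id f = π := by
    refine LinearMap.prod_ext ?_ ?_
    · ext x
      simp
    · rw [hfg]
      ext x
      simp only [LinearMap.comp_apply, LinearMap.inr_apply, LinearMap.prodMap_apply,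
        LinearMap.coprod_apply, map_zero, zero_add]
  rw [← LinearMap.comp_assoc, hfactor, hπσ]
end

section
/- Let A be a commutative ring, P a 2-almost projective A-module, and N ⊆ P a finitely generated submodule. Then the quotient P/N is a 2-almost projective A-module. -/
theorem IsTwoAlmostProjective.of_comp_eq_id {A : Type u} [CommRing A] {X M : Type v}
    [AddCommGroup X] [Module A X] [AddCommGroup M] [Module A M]
    (hX : IsTwoAlmostProjective A X) (p : X →ₗ[A] M) (s : M →ₗ[A] X)
    (h : p ∘ₗ s = LinearMap.id) : IsTwoAlmostProjective A M := by
  obtain ⟨Q, F, _, _, _, _, hQ, hF, π, σ, hπ⟩ := hX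
  refine ⟨Q, F, _, _, _, _, hQ, hF, p ∘ₗ π, σ ∘ₗ s, ?_⟩
  calc (p ∘ₗ π) ∘ₗ (σ ∘ₗ s) = p ∘ₗ (π ∘ₗ σ) ∘ₗ s := rfl
    _ = LinearMap.id := by rw [hπ, LinearMap.id_comp, h]

/-- The ring `A` itself may be too large for the universe of a projective module `Q`; still, any
finite subset of `Q` is killed by some `r` such that `A ⧸ (r)` is small enough. -/
theorem Module.Projective.exists_smul_eq_zero_small_quotient {A : Type u} [CommRing A]
    {Q : Type v} [AddCommGroup Q] [Module A Q] [hQ : Module.Projective A Q] (L : Finset Q) :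
    ∃ r : A, (∀ x ∈ L, r • x = 0) ∧ Small.{v} (A ⧸ Ideal.span {r}) := by
  classical
  obtain ⟨s, hs⟩ := Module.projective_def.1 hQ
  have hsum (x : Q) : ((s x).sum fun i a ↦ a • i) = x := by
    simpa [Finsupp.linearCombination_apply] using hs x
  let trace : (Q →₀ Q) →ₗ[A] A := Finsupp.lsum ℕ fun i ↦ Finsupp.lapply i ∘ₗ s
  let T : Ideal A := LinearMap.range trace
  have hT (i x : Q) : s x i ∈ T := ⟨Finsupp.single i x, by simp [trace]⟩
  let c : Ideal A := Ideal.span (L.biUnion fun x ↦ (s x).support.image (s x))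
  have hc (x : Q) (hx : x ∈ L) (i : Q) : s x i ∈ c := by
    by_cases h : s x i = 0
    · rw [h]; exact c.zero_mem
    · refine Ideal.subset_span ?_
      simp only [Finset.coe_biUnion, Set.mem_iUnion, Finset.mem_coe, Finset.mem_image]
      exact ⟨x, hx, i, Finsupp.mem_support_iff.2 h, rfl⟩
  have hcT : c ≤ T • c := by
    refine Ideal.span_le.2 fun a ha ↦ ?_
    simp only [Finset.coe_biUnion, Set.mem_iUnion, Finset.mem_coe, Finset.mem_image] at ha
    obtain ⟨x, hx, k, -, rfl⟩ := ha
    have : s x k = (s x).sum fun i a ↦ a * s i k := by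
      conv_lhs => rw [← hsum x]
      simp [Finsupp.sum, map_sum, Finsupp.finsetSum_apply]
    rw [SetLike.mem_coe, this]
    refine Submodule.sum_mem _ fun i _ ↦ ?_
    dsimp only
    rw [mul_comm (s x i)]
    exact Submodule.smul_mem_smul (hT k i) (hc x hx i)
  obtain ⟨r, hrT, hr⟩ := Submodule.exists_sub_one_mem_and_smul_eq_zero_of_fg_of_le_smul T c
    ⟨_, rfl⟩ hcT
  refine ⟨r, fun x hx ↦ ?_, ?_⟩
  · rw [← hsum x, Finsupp.sum, Finset.smul_sum]
    refine Finset.sum_eq_zero fun i _ ↦ ?_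
    rw [smul_smul, ← smul_eq_mul, hr _ (hc x hx i), zero_smul]
  · refine small_of_surjective (f := fun y ↦ Ideal.Quotient.mk (Ideal.span {r}) (trace y)) ?_
    intro a
    obtain ⟨a, rfl⟩ := Ideal.Quotient.mk_surjective a
    obtain ⟨y, hy⟩ : -(a * (r - 1)) ∈ T := T.neg_mem (T.mul_mem_left a hrT)
    refine ⟨y, ?_⟩
    dsimp only
    rw [hy, Ideal.Quotient.eq, Ideal.mem_span_singleton]
    exact ⟨-a, by ring⟩

theorem IsTwoAlmostProjective.quotient_prod {A : Type u} [CommRing A] {Q F : Type v}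
    [AddCommGroup Q] [Module A Q] [AddCommGroup F] [Module A F]
    [hQ : Module.Projective A Q] [hF : Module.FinitePresentation A F]
    (N : Submodule A (Q × F)) (hN : N.FG) : IsTwoAlmostProjective A ((Q × F) ⧸ N) := by
  classical
  obtain ⟨s, hs⟩ := Module.projective_def.1 hQ
  obtain ⟨G, rfl⟩ := hN
  let L : Finset Q := G.biUnion fun g ↦ (s g.1).support
  obtain ⟨r, hrL, hr⟩ := Module.Projective.exists_smul_eq_zero_small_quotient (A := A) L
  let B := A ⧸ Ideal.span {r}
  have : Module.FinitePresentation A B :=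
    Module.finitePresentation_of_surjective (Submodule.mkQ (Ideal.span {r}))
      (Submodule.mkQ_surjective _) (by rw [Submodule.ker_mkQ]; exact ⟨{r}, by simp⟩)
  let sL : Q →ₗ[A] (L → B) :=
    LinearMap.pi fun i ↦ Submodule.mkQ (Ideal.span {r}) ∘ₗ Finsupp.lapply i.1 ∘ₗ s
  let pL : (L → B) →ₗ[A] Q := LinearMap.lsum A (fun _ ↦ B) ℕ fun i ↦
    Submodule.liftQ (Ideal.span {r}) (LinearMap.toSpanSingleton A Q i.1) (by
      rw [Ideal.span_le]
      simpa using hrL _ i.2)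
  have hpsL (q : Q) : pL (sL q) = ∑ i ∈ L, s q i • i := by
    rw [← Finset.sum_coe_sort]
    simp only [pL, sL, LinearMap.lsum_apply, LinearMap.sum_apply, LinearMap.comp_apply,
      LinearMap.proj_apply, LinearMap.pi_apply]
    refine Finset.sum_congr rfl fun i _ ↦ ?_
    rw [Submodule.mkQ_apply, Submodule.liftQ_apply]
    simp
  let sF : Q × F →ₗ[A] (L → B) × F := sL.prodMap LinearMap.id
  let pF : (L → B) × F →ₗ[A] Q × F := pL.prodMap LinearMap.id
  have hfix : ∀ n ∈ Submodule.span A (G : Set (Q × F)), pL (sL n.1) = n.1 := by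
    intro n hn
    have : Submodule.span A (G : Set (Q × F)) ≤
        LinearMap.eqLocus (pL ∘ₗ sL ∘ₗ LinearMap.fst A Q F) (LinearMap.fst A Q F) := by
      refine Submodule.span_le.2 fun g hg ↦ ?_
      change pL (sL g.1) = g.1
      rw [hpsL]
      refine Eq.trans ?_ (hs g.1)
      rw [Finsupp.linearCombination_apply]
      refine (Finsupp.sum_of_support_subset (s g.1) ?_ (fun i a ↦ a • id i) (by simp)).symm
      exact Finset.subset_biUnion_of_mem (fun g : Q × F ↦ (s g.1).support) hg
    exact this hn
  set N := Submodule.span A (G : Set (Q × F))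
  let K : Submodule A ((L → B) × F) := N.map sF
  have hK : K.FG := Submodule.FG.map _ ⟨G, rfl⟩
  have hfp : Module.FinitePresentation A (((L → B) × F) ⧸ K) :=
    Module.finitePresentation_of_surjective K.mkQ K.mkQ_surjective
      (by rwa [Submodule.ker_mkQ])
  have : Small.{v} B := hr
  have : Small.{v} (((L → B) × F) ⧸ K) := small_of_surjective K.mkQ_surjective
  let e := Shrink.linearEquiv.{v} A (((L → B) × F) ⧸ K)
  have hKN : K ≤ N.comap pF := by
    rintro _ ⟨n, hn, rfl⟩
    change (pL (sL n.1), n.2) ∈ N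
    rwa [hfix n hn]
  let α₁ : (Q × F) ⧸ N →ₗ[A] Q := N.liftQ
    ((LinearMap.id - pL ∘ₗ sL) ∘ₗ LinearMap.fst A Q F) fun n hn ↦ by
      simp [hfix n hn]
  let α₂ : (Q × F) ⧸ N →ₗ[A] ((L → B) × F) ⧸ K := N.mapQ K sF (Submodule.le_comap_map _ _)
  let β₁ : Q →ₗ[A] (Q × F) ⧸ N := N.mkQ ∘ₗ LinearMap.inl A Q F
  let β₂ : ((L → B) × F) ⧸ K →ₗ[A] (Q × F) ⧸ N := K.mapQ N pF hKN
  refine ⟨Q, Shrink.{v} (((L → B) × F) ⧸ K), _, _, _, _, hQ,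
    Module.FinitePresentation.of_equiv e.symm, β₁.coprod (β₂ ∘ₗ e.toLinearMap),
    α₁.prod (e.symm.toLinearMap ∘ₗ α₂), ?_⟩
  refine LinearMap.ext fun x ↦ ?_
  obtain ⟨x, rfl⟩ := N.mkQ_surjective x
  change N.mkQ (x.1 - pL (sL x.1), 0) + β₂ (e (e.symm (K.mkQ (sF x)))) = N.mkQ x
  rw [e.apply_symm_apply]
  change N.mkQ (x.1 - pL (sL x.1), 0) + N.mkQ (pL (sL x.1), x.2) = N.mkQ x
  rw [← map_add]
  simp

/-- The quotient of a 2-almost projective module by a finitely generated submodule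
is 2-almost projective. -/
theorem IsTwoAlmostProjective.quotient
    {A : Type u} [CommRing A] {P : Type v} [AddCommGroup P] [Module A P]
    (hP : IsTwoAlmostProjective A P) (N : Submodule A P) (hN : N.FG) :
    IsTwoAlmostProjective A (P ⧸ N) := by
  obtain ⟨Q, F, _, _, _, _, hQ, hF, π, σ, hπ⟩ := hP
  have hπσ (x : P) : π (σ x) = x := LinearMap.congr_fun hπ x
  refine (IsTwoAlmostProjective.quotient_prod (N.map σ) (hN.map σ)).of_comp_eq_id
    ((N.map σ).mapQ N π ?_) (N.mapQ (N.map σ) σ (Submodule.le_comap_map _ _)) ?_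
  · rintro _ ⟨n, hn, rfl⟩
    simpa [hπσ] using hn
  · ext x
    simp [hπσ]
end

section
/- Let A be a commutative ring and (M_α, f_{βα}) a directed inverse system of A-modules such that: (a) all transition maps f_{βα} : M_β → M_α (for α ≤ β) are surjective with finitely generated kernels, and (b) for every index α there exists β ≥ α such that f_{βα} factors as M_β → P → M_α for some projective A-module P. Then every module M_α in the system is 2-almost projective. -/
/-- On a finitely generated submodule of a projective module, the identity agrees with an
endomorphism factoring through a finite free module. -/
theorem Module.Projective.exists_finite_factorization_of_fg {A : Type*} [CommRing A] {Q : Type v}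
    [AddCommGroup Q] [Module A Q] [Module.Projective A Q] {N : Submodule A Q} (hN : N.FG) :
    ∃ (κ : Type v) (_ : Fintype κ) (φ : Q →ₗ[A] κ → A) (x : (κ → A) →ₗ[A] Q),
      ∀ q ∈ N, x (φ q) = q := by
  classical
  obtain ⟨s, hs⟩ := Module.projective_def'.mp (inferInstance : Module.Projective A Q)
  obtain ⟨T, rfl⟩ := hN
  let S : Finset Q := T.biUnion fun t => (s t).support
  refine ⟨S, inferInstance, LinearMap.pi fun i => Finsupp.lapply (i : Q) ∘ₗ s,
    Fintype.linearCombination A (fun i : S => (i : Q)), fun q hq => ?_⟩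
  induction hq using Submodule.span_induction with
  | mem q hq =>
    have hsub : (s q).support ⊆ S := Finset.subset_biUnion_of_mem (fun t => (s t).support) hq
    have hsq : Finsupp.linearCombination A id (s q) = q := LinearMap.congr_fun hs q
    rw [Finsupp.linearCombination_apply, Finsupp.sum_of_support_subset _ hsub _ (by simp)] at hsq
    simpa [Fintype.linearCombination_apply] using
      (Finset.sum_coe_sort S fun i => s q i • i).trans hsq
  | zero => simp
  | add a b _ _ ha hb => rw [map_add, map_add, ha, hb]
  | smul c a _ ha => rw [map_smul, map_smul, ha]

/-- A finitely generated submodule of a projective module `Q` is annihilated by some `d` such that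
`A ⧸ (d)` is no larger than the universe of `Q`. -/
theorem Module.Projective.exists_smul_eq_zero_and_small {A : Type*} [CommRing A] {Q : Type v}
    [AddCommGroup Q] [Module A Q] [Module.Projective A Q] {N : Submodule A Q} (hN : N.FG) :
    ∃ d : A, (∀ q ∈ N, d • q = 0) ∧ Small.{v} (A ⧸ Ideal.span {d}) := by
  classical
  obtain ⟨κ, _, φ, x, hx⟩ := Module.Projective.exists_finite_factorization_of_fg hN
  let P : Matrix κ κ A := LinearMap.toMatrix' (φ ∘ₗ x)
  refine ⟨(1 - P).det, fun q hq => ?_, ?_⟩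
  · have hker : (1 - P).mulVec (φ q) = 0 := by
      rw [Matrix.sub_mulVec, Matrix.one_mulVec, LinearMap.toMatrix'_mulVec, LinearMap.comp_apply,
        hx q hq, sub_self]
    have hdet : (1 - P).det • φ q = 0 := by
      rw [← Matrix.one_mulVec (φ q), ← Matrix.smul_mulVec, ← Matrix.adjugate_mul,
        ← Matrix.mulVec_mulVec, hker, Matrix.mulVec_zero]
    rw [← hx q hq, ← map_smul, hdet, map_zero]
  · let ψ : (κ → Q) →ₗ[A] A := ∑ i, LinearMap.proj i ∘ₗ φ ∘ₗ LinearMap.proj i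
    let R : Ideal A := LinearMap.range ψ
    have hP : ∀ i j, P i j ∈ R := fun i j => by
      refine ⟨Pi.single i (x (Pi.single j 1)), ?_⟩
      simp only [ψ, LinearMap.sum_apply, LinearMap.comp_apply, LinearMap.proj_apply]
      rw [Finset.sum_eq_single i (fun k _ hk => by simp [Pi.single_eq_of_ne hk]) (by simp)]
      simp [P, LinearMap.toMatrix'_apply]
    have hone : 1 - (1 - P).det ∈ R := by
      have hmap : (Ideal.Quotient.mk R).mapMatrix P = 0 := by
        ext i j
        simpa using Ideal.Quotient.eq_zero_iff_mem.mpr (hP i j)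
      rw [← Ideal.Quotient.eq_zero_iff_mem, map_sub, RingHom.map_det, map_sub, hmap]
      simp
    refine small_of_surjective (f := fun q => Ideal.Quotient.mk (Ideal.span {(1 - P).det}) (ψ q))
      fun y => ?_
    obtain ⟨a, rfl⟩ := Ideal.Quotient.mk_surjective y
    obtain ⟨q, hq⟩ := R.mul_mem_left a hone
    refine ⟨q, ?_⟩
    change Ideal.Quotient.mk _ (ψ q) = _
    rw [hq, Ideal.Quotient.mk_eq_mk_iff_sub_mem, Ideal.mem_span_singleton]
    exact ⟨-a, by ring⟩

/-- If a surjection with finitely generated kernel factors through a projective module, then its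
target is 2-almost projective. -/
theorem IsTwoAlmostProjective.of_surjective_of_factors {A : Type u} [CommRing A]
    {B : Type*} {M Q : Type v} [AddCommGroup B] [Module A B] [AddCommGroup M] [Module A M]
    [AddCommGroup Q] [Module A Q] [Module.Projective A Q] (g : B →ₗ[A] M)
    (hg : Function.Surjective g) (hker : (LinearMap.ker g).FG)
    (u : B →ₗ[A] Q) (w : Q →ₗ[A] M) (hwu : w ∘ₗ u = g) : IsTwoAlmostProjective A M := by
  classical
  have hwu' (b : B) : w (u b) = g b := LinearMap.congr_fun hwu b
  obtain ⟨κ, _, φ, x, hx⟩ :=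
    Module.Projective.exists_finite_factorization_of_fg (hker.map u)
  obtain ⟨d, hd, _⟩ := Module.Projective.exists_smul_eq_zero_and_small
    (N := LinearMap.range x) (Module.Finite.iff_fg.mp inferInstance)
  let D : Submodule A (κ → A) := LinearMap.range (d • LinearMap.id : (κ → A) →ₗ[A] κ → A)
  let L : Submodule A (κ → A) := ((LinearMap.ker g).map u).map φ ⊔ D
  have hL : L.FG := ((hker.map u).map φ).sup (Module.Finite.iff_fg.mp inferInstance)
  have hFP : Module.FinitePresentation A ((κ → A) ⧸ L) :=
    Module.finitePresentation_of_surjective L.mkQ L.mkQ_surjective (by rwa [L.ker_mkQ])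
  have hsmall : Small.{v} ((κ → A) ⧸ L) := by
    refine small_of_surjective (α := κ → A ⧸ Ideal.span {d})
      (f := fun y => L.mkQ fun i => (Ideal.Quotient.mk_surjective (y i)).choose) fun z => ?_
    obtain ⟨a, rfl⟩ := L.mkQ_surjective z
    refine ⟨fun i => Ideal.Quotient.mk _ (a i), (Submodule.Quotient.eq L).mpr ?_⟩
    apply (le_sup_right : D ≤ L)
    have hdiv (i : κ) : ∃ c, (Ideal.Quotient.mk_surjective (I := Ideal.span {d})
        (Ideal.Quotient.mk _ (a i))).choose - a i = d * c :=
      Ideal.mem_span_singleton.mp ((Ideal.Quotient.mk_eq_mk_iff_sub_mem _ _).mp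
        (Ideal.Quotient.mk_surjective (I := Ideal.span {d})
          (Ideal.Quotient.mk _ (a i))).choose_spec)
    choose c hc using hdiv
    exact ⟨c, funext fun i => (hc i).symm⟩
  have hxL : L ≤ LinearMap.ker (w ∘ₗ x) := by
    refine sup_le ?_ ?_
    · rintro _ ⟨q, ⟨b, hb, rfl⟩, rfl⟩
      rw [LinearMap.mem_ker, LinearMap.comp_apply, hx _ ⟨b, hb, rfl⟩, hwu']
      exact hb
    · rintro _ ⟨a, rfl⟩
      simp [← map_smul w, hd (x a) ⟨a, rfl⟩]
  let E : Shrink.{v} ((κ → A) ⧸ L) ≃ₗ[A] (κ → A) ⧸ L := Shrink.linearEquiv A _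
  let τ : B →ₗ[A] Q × Shrink.{v} ((κ → A) ⧸ L) :=
    (u - x ∘ₗ φ ∘ₗ u).prod (E.symm.toLinearMap ∘ₗ L.mkQ ∘ₗ φ ∘ₗ u)
  have hτ : LinearMap.ker g ≤ LinearMap.ker τ := by
    intro b hb
    have hmem : φ (u b) ∈ L :=
      (le_sup_left : _ ≤ L) ⟨u b, ⟨b, hb, rfl⟩, rfl⟩
    have hzero : L.mkQ (φ (u b)) = 0 := (Submodule.Quotient.mk_eq_zero L).mpr hmem
    refine Prod.ext ?_ ?_
    · change u b - x (φ (u b)) = 0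
      rw [hx _ ⟨b, hb, rfl⟩, sub_self]
    · change E.symm (L.mkQ (φ (u b))) = 0
      rw [hzero, map_zero]
  let e := g.quotKerEquivOfSurjective hg
  refine ⟨Q, Shrink.{v} ((κ → A) ⧸ L), inferInstance, inferInstance, inferInstance, inferInstance,
    inferInstance, Module.FinitePresentation.of_equiv E.symm,
    w.coprod (L.liftQ (w ∘ₗ x) hxL ∘ₗ E.toLinearMap),
    (LinearMap.ker g).liftQ τ hτ ∘ₗ e.symm.toLinearMap, ?_⟩
  ext m
  obtain ⟨b, rfl⟩ := hg m
  have he : e.symm (g b) = (LinearMap.ker g).mkQ b := by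
    rw [LinearEquiv.symm_apply_eq]
    rfl
  simp [he, τ, hwu']

/-- If `(M α, f)` is a directed inverse system of `A`-modules with surjective
transition maps having finitely generated kernels, and every transition map
eventually factors through a projective module, then each `M α` is
2-almost projective. -/
theorem IsTwoAlmostProjective.of_proProjective_system
    {A : Type u} [CommRing A] {ι : Type w} [Preorder ι] [IsDirected ι (· ≤ ·)]
    (M : ι → Type v) [∀ α, AddCommGroup (M α)] [∀ α, Module A (M α)]
    (f : ∀ {α β : ι}, α ≤ β → (M β →ₗ[A] M α))
    (h_id : ∀ α : ι, f (le_refl α) = LinearMap.id)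
    (h_comp : ∀ {α β γ : ι} (hαβ : α ≤ β) (hβγ : β ≤ γ),
      (f hαβ) ∘ₗ (f hβγ) = f (hαβ.trans hβγ))
    (h_surj : ∀ {α β : ι} (h : α ≤ β), Function.Surjective (f h))
    (h_ker : ∀ {α β : ι} (h : α ≤ β), (LinearMap.ker (f h)).FG)
    (h_fact : ∀ α : ι, ∃ β : ι, ∃ hαβ : α ≤ β,
      ∃ (Q : Type v) (_ : AddCommGroup Q) (_ : Module A Q),
        Module.Projective A Q ∧
          ∃ (u : M β →ₗ[A] Q) (v : Q →ₗ[A] M α), v ∘ₗ u = f hαβ) :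
    ∀ α : ι, IsTwoAlmostProjective A (M α) := by
  intro α
  obtain ⟨β, hαβ, Q, _, _, _, u, v, huv⟩ := h_fact α
  exact .of_surjective_of_factors (f hαβ) (h_surj hαβ) (h_ker hαβ) u v huv
end

section
/- Let A be a commutative ring and (M_α, f_{βα}) a directed inverse system of A-modules such that: (a) every M_α is a finitely generated A-module, (b) all transition maps f_{βα} (for α ≤ β) are surjective, and (c) for every index α there exists β ≥ α such that f_{βα} factors through a projective A-module. Then for every index α there exist an index β ≥ α and a finite free A-module F such that f_{βα} factors as M_β → F → M_α. -/
/-- In a directed inverse system of finitely generated `A`-modules with surjective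
transition maps, if every transition map eventually factors through a projective
module, then it eventually factors through a finite free module. -/
theorem exists_factor_through_finite_free
    {A : Type u} [CommRing A] {ι : Type w} [Preorder ι] [IsDirected ι (· ≤ ·)]
    (M : ι → Type v) [∀ α, AddCommGroup (M α)] [∀ α, Module A (M α)]
    [∀ α, Module.Finite A (M α)]
    (f : ∀ {α β : ι}, α ≤ β → (M β →ₗ[A] M α))
    (h_id : ∀ α : ι, f (le_refl α) = LinearMap.id)
    (h_comp : ∀ {α β γ : ι} (hαβ : α ≤ β) (hβγ : β ≤ γ),
      (f hαβ) ∘ₗ (f hβγ) = f (hαβ.trans hβγ))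
    (h_surj : ∀ {α β : ι} (h : α ≤ β), Function.Surjective (f h))
    (h_fact : ∀ α : ι, ∃ (β : ι) (hαβ : α ≤ β)
      (P : Type v) (_ : AddCommGroup P) (_ : Module A P),
      Module.Projective A P ∧
        ∃ (u : M β →ₗ[A] P) (v : P →ₗ[A] M α), v ∘ₗ u = f hαβ) :
    ∀ α : ι, ∃ (β : ι) (hαβ : α ≤ β) (n : ℕ)
      (u : M β →ₗ[A] (Fin n → A)) (v : (Fin n → A) →ₗ[A] M α),
      v ∘ₗ u = f hαβ := by
  intro α
  obtain ⟨β, hαβ, P, _, _, hP, u, v, huv⟩ := h_fact α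
  obtain ⟨n, π, hπ⟩ := Module.Finite.exists_fin' A (M α)
  obtain ⟨w, hw⟩ := Module.projective_lifting_property π v hπ
  exact ⟨β, hαβ, n, w ∘ₗ u, π, by rw [← LinearMap.comp_assoc, hw, huv]⟩
end

section
/- Let A → B → C be homomorphisms of commutative rings such that C is formally smooth as a B-algebra. Then the canonical C-linear map Ω_{B/A} ⊗_B C → Ω_{C/A} of Kähler differentials is universally injective: for every C-module M, the induced map (Ω_{B/A} ⊗_B C) ⊗_C M → Ω_{C/A} ⊗_C M is injective. -/
/-- If `A → B → C` are commutative rings with `C` formally smooth over `B`, the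
canonical map `Ω[B⁄A] ⊗[B] C → Ω[C⁄A]` is universally injective: for every
`C`-module `M`, the induced map after tensoring with `M` is injective. -/
theorem KaehlerDifferential.mapBaseChange_universally_injective_of_formallySmooth
    (A B C : Type u) [CommRing A] [CommRing B] [CommRing C]
    [Algebra A B] [Algebra B C] [Algebra A C] [IsScalarTower A B C]
    [Algebra.FormallySmooth B C]
    (M : Type v) [AddCommGroup M] [Module C M] :
    Function.Injective
      (LinearMap.rTensor M (KaehlerDifferential.mapBaseChange A B C)) := by
  have h_inj : Function.Injective (KaehlerDifferential.mapBaseChange A B C) := by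
    rw [injective_iff_map_eq_zero]
    intro x hx
    obtain ⟨y, rfl⟩ := (Algebra.H1Cotangent.exact_δ_mapBaseChange A B C x).mp hx
    rw [Subsingleton.elim y 0, map_zero]
  obtain ⟨s, hs⟩ := Module.projective_lifting_property (KaehlerDifferential.map A B C C)
    LinearMap.id (KaehlerDifferential.map_surjective A B C)
  obtain ⟨r, hr⟩ : ∃ r, r ∘ₗ KaehlerDifferential.mapBaseChange A B C = LinearMap.id := by
    have h_split := (KaehlerDifferential.exact_mapBaseChange_map A B C).split_tfae'
    have h_iff := h_split.out 0 1
    exact (h_iff.mp ⟨h_inj, s, hs⟩).2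
  refine Function.LeftInverse.injective (g := LinearMap.rTensor M r) fun x ↦ ?_
  rw [← LinearMap.comp_apply, ← LinearMap.rTensor_comp, hr, LinearMap.rTensor_id,
    LinearMap.id_apply]
end

section
/- Let k be a field and (R_n)_{n∈ℕ} a directed system of commutative k-algebras indexed by the natural numbers, with k-algebra transition maps t_n : R_n → R_{n+1}. Assume that each R_n is a smooth k-algebra (formally smooth and of finite presentation over k) and that each transition map t_n makes R_{n+1} a smooth R_n-algebra. Then the direct limit A = colim_n R_n is formally smooth over k. -/
/-- The composite transition map `R m →ₐ[k] R (m + j)` of a ℕ-indexed directed system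
of `k`-algebras with one-step transition maps `t n : R n →ₐ[k] R (n+1)`. -/
def DirectedSystem.iterTrans {k : Type u} [CommRing k]
    {R : ℕ → Type u} [∀ n, CommRing (R n)] [∀ n, Algebra k (R n)]
    (t : ∀ n : ℕ, R n →ₐ[k] R (n + 1)) (m : ℕ) : ∀ j : ℕ, R m →ₐ[k] R (m + j)
  | 0 => AlgHom.id k (R m)
  | j + 1 => (t (m + j)).comp (DirectedSystem.iterTrans t m j)

/-- If `t : R → S` is formally smooth and `I` is a square-zero ideal of `B`, then a lift to `B` of
the restriction along `t` of a map `v : S → B ⧸ I` extends to a lift of `v`. -/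
theorem Algebra.FormallySmooth.exists_lift_comp_eq
    {k R S B : Type*} [CommRing k] [CommRing R] [CommRing S] [CommRing B]
    [Algebra k R] [Algebra k S] [Algebra k B] (t : R →ₐ[k] S)
    (ht : t.toRingHom.FormallySmooth) (I : Ideal B) (hI : I ^ 2 = ⊥)
    (u : R →ₐ[k] B) (v : S →ₐ[k] B ⧸ I)
    (huv : (Ideal.Quotient.mkₐ k I).comp u = v.comp t) :
    ∃ w : S →ₐ[k] B, w.comp t = u ∧ (Ideal.Quotient.mkₐ k I).comp w = v := by
  let : Algebra R S := t.toRingHom.toAlgebra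
  let : Algebra R B := u.toRingHom.toAlgebra
  have : Algebra.FormallySmooth R S := ht
  let v' : S →ₐ[R] B ⧸ I :=
    { v.toRingHom with commutes' := fun r => (DFunLike.congr_fun huv r).symm }
  obtain ⟨w, hw⟩ := Algebra.FormallySmooth.comp_surjective R S I hI v'
  have hwt : ∀ r, w (t r) = u r := fun r => w.commutes r
  refine ⟨{ w.toRingHom with commutes' := fun c => ?_ }, AlgHom.ext hwt,
    AlgHom.ext fun s => DFunLike.congr_fun hw s⟩
  exact (congrArg w (t.commutes c).symm).trans ((hwt _).trans (u.commutes c))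

/-- A compatible family of algebra maps out of a `ℕ`-indexed directed system factors through its
direct limit. -/
theorem DirectedSystem.exists_algHom_comp_eq
    {k : Type u} [CommRing k] {R : ℕ → Type u} [∀ n, CommRing (R n)] [∀ n, Algebra k (R n)]
    (t : ∀ n : ℕ, R n →ₐ[k] R (n + 1))
    {A : Type*} [CommRing A] [Algebra k A] (g : ∀ n : ℕ, R n →ₐ[k] A)
    (h_compat : ∀ n : ℕ, (g (n + 1)).comp (t n) = g n)
    (h_surj : ∀ a : A, ∃ (n : ℕ) (x : R n), g n x = a)
    (h_ker : ∀ (n : ℕ) (x : R n), g n x = 0 →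
      ∃ j : ℕ, DirectedSystem.iterTrans t n j x = 0)
    {B : Type*} [CommRing B] [Algebra k B] (φ : ∀ n : ℕ, R n →ₐ[k] B)
    (hφ : ∀ n : ℕ, (φ (n + 1)).comp (t n) = φ n) :
    ∃ F : A →ₐ[k] B, ∀ n, F.comp (g n) = φ n := by
  have iter : ∀ n j x, φ (n + j) (iterTrans t n j x) = φ n x := by
    intro n j x
    induction j with
    | zero => rfl
    | succ j ih => exact (DFunLike.congr_fun (hφ (n + j)) _).trans ih
  have push : ∀ m n, m ≤ n → ∀ x : R m, ∃ y : R n, g n y = g m x ∧ φ n y = φ m x := by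
    intro m n hmn x
    induction n, hmn using Nat.le_induction with
    | base => exact ⟨x, rfl, rfl⟩
    | succ n _ ih =>
      obtain ⟨y, hy, hy'⟩ := ih
      exact ⟨t n y, (DFunLike.congr_fun (h_compat n) y).trans hy,
        (DFunLike.congr_fun (hφ n) y).trans hy'⟩
  have zero : ∀ n x, g n x = 0 → φ n x = 0 := by
    intro n x hx
    obtain ⟨j, hj⟩ := h_ker n x hx
    rw [← iter n j x, hj, map_zero]
  have well : ∀ m n x y, g m x = g n y → φ m x = φ n y := by
    intro m n x y h
    obtain ⟨x', hx, hx'⟩ := push m (max m n) (le_max_left _ _) x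
    obtain ⟨y', hy, hy'⟩ := push n (max m n) (le_max_right _ _) y
    rw [← hx', ← hy', ← sub_eq_zero, ← map_sub]
    apply zero
    rw [map_sub, hx, hy, h, sub_self]
  have common : ∀ a b : A, ∃ n, ∃ x y : R n, g n x = a ∧ g n y = b := by
    intro a b
    obtain ⟨m, x, rfl⟩ := h_surj a
    obtain ⟨n, y, rfl⟩ := h_surj b
    obtain ⟨x', hx, -⟩ := push m (max m n) (le_max_left _ _) x
    obtain ⟨y', hy, -⟩ := push n (max m n) (le_max_right _ _) y
    exact ⟨_, x', y', hx, hy⟩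
  choose N X hX using h_surj
  have key : ∀ n x, φ (N (g n x)) (X (g n x)) = φ n x := fun n x => well _ _ _ _ (hX _)
  refine ⟨AlgHom.ofLinearMap
    { toFun := fun a => φ (N a) (X a)
      map_add' := ?_
      map_smul' := ?_ } ?_ ?_, fun n => AlgHom.ext fun x => key n x⟩
  · intro a b
    obtain ⟨n, x, y, rfl, rfl⟩ := common a b
    rw [← map_add, key, key, key, map_add]
  · intro c a
    obtain ⟨n, x, -, rfl, -⟩ := common a a
    rw [← map_smul, key, key, map_smul, RingHom.id_apply]
  · change φ (N 1) (X 1) = 1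
    rw [← map_one (g 0), key, map_one]
  · intro a b
    change φ (N (a * b)) (X (a * b)) = φ (N a) (X a) * φ (N b) (X b)
    obtain ⟨n, x, y, rfl, rfl⟩ := common a b
    rw [← map_mul, key, key, key, map_mul]

/-- Let `k` be a field and `(R n)` a ℕ-indexed directed system of smooth `k`-algebras
whose transition maps `t n : R n → R (n+1)` are smooth. Then the direct limit
`A = colim R n` (presented here by compatible maps `g n : R n → A` which are jointly
surjective and whose kernels are eventually killed in the system) is formally smooth
over `k`. -/
theorem Algebra.FormallySmooth.of_directLimit_of_smooth
    {k : Type u} [Field k]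
    (R : ℕ → Type u) [∀ n, CommRing (R n)] [∀ n, Algebra k (R n)]
    (t : ∀ n : ℕ, R n →ₐ[k] R (n + 1))
    (hsmooth : ∀ n : ℕ, Algebra.Smooth k (R n))
    (hstep : ∀ n : ℕ,
      @Algebra.Smooth (R n) _ (R (n + 1)) _ ((t n).toRingHom.toAlgebra))
    (A : Type u) [CommRing A] [Algebra k A]
    (g : ∀ n : ℕ, R n →ₐ[k] A)
    (h_compat : ∀ n : ℕ, (g (n + 1)).comp (t n) = g n)
    (h_surj : ∀ a : A, ∃ (n : ℕ) (x : R n), g n x = a)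
    (h_ker : ∀ (n : ℕ) (x : R n), g n x = 0 →
      ∃ j : ℕ, DirectedSystem.iterTrans t n j x = 0) :
    Algebra.FormallySmooth k A := by
  refine .of_comp_surjective fun B _ _ I hI f => ?_
  have step : ∀ n (u : R n →ₐ[k] B), (Ideal.Quotient.mkₐ k I).comp u = f.comp (g n) →
      ∃ w : R (n + 1) →ₐ[k] B, w.comp (t n) = u ∧
        (Ideal.Quotient.mkₐ k I).comp w = f.comp (g (n + 1)) := fun n u hu =>
    exists_lift_comp_eq (t n) (hstep n).formallySmooth I hI u _
      (by rw [hu, AlgHom.comp_assoc, h_compat])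
  choose next next_comp mk_next using step
  have := (hsmooth 0).formallySmooth
  obtain ⟨φ₀, hφ₀⟩ := comp_surjective k (R 0) I hI (f.comp (g 0))
  let φ : ∀ n, { u : R n →ₐ[k] B // (Ideal.Quotient.mkₐ k I).comp u = f.comp (g n) } := fun n =>
    Nat.rec ⟨φ₀, hφ₀⟩ (fun n u => ⟨next n u.1 u.2, mk_next n u.1 u.2⟩) n
  obtain ⟨F, hF⟩ := DirectedSystem.exists_algHom_comp_eq t g h_compat h_surj h_ker
    (fun n => (φ n).1) fun n => next_comp n (φ n).1 (φ n).2
  refine ⟨F, AlgHom.ext fun a => ?_⟩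
  obtain ⟨n, x, rfl⟩ := h_surj a
  have hx : F (g n x) = (φ n).1 x := DFunLike.congr_fun (hF n) x
  rw [AlgHom.comp_apply, hx]
  exact DFunLike.congr_fun (φ n).2 x
end
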